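/- arXiv:2210.12053 — 4 statements merged into one kernel-verified Lean document; each statement's English description precedes it below -/
import Mathlib

section
/- Let K be an n×n complex matrix with rank(K) = p and let r₀ ∈ ℂⁿ. Then for every natural number m, the Krylov subspace K^m(I + K; r₀) = span{r₀, (I+K)r₀, …, (I+K)^{m−1} r₀} has dimension at most p + 1. -/
open Matrix

/-- If `rank K = p`, then the Krylov subspace
`K^m(I + K; r₀) = span{r₀, (I+K)r₀, …, (I+K)^{m-1} r₀}` has dimension at most `p + 1`. -/
theorem krylov_subspace_dim_le (n p : ℕ) (K : Matrix (Fin n) (Fin n) ℂ)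
    (hrank : K.rank = p) (r₀ : Fin n → ℂ) (m : ℕ) :
    Module.finrank ℂ
        ↥(Submodule.span ℂ
          {v : Fin n → ℂ | ∃ j < m, v = (((1 : Matrix (Fin n) (Fin n) ℂ) + K) ^ j) *ᵥ r₀}) ≤
      p + 1 := by
  have hmem : ∀ j : ℕ, (((1 : Matrix (Fin n) (Fin n) ℂ) + K) ^ j) *ᵥ r₀ ∈
      LinearMap.range K.mulVecLin ⊔ Submodule.span ℂ {r₀} := by
    intro j
    induction j with
    | zero =>
      rw [pow_zero, one_mulVec]
      exact Submodule.mem_sup_right (Submodule.mem_span_singleton_self r₀)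
    | succ j ih =>
      rw [pow_succ', ← mulVec_mulVec, add_mulVec, one_mulVec]
      exact Submodule.add_mem _ ih (Submodule.mem_sup_left ⟨_, rfl⟩)
  have hle : Submodule.span ℂ
      {v : Fin n → ℂ | ∃ j < m, v = (((1 : Matrix (Fin n) (Fin n) ℂ) + K) ^ j) *ᵥ r₀} ≤
      LinearMap.range K.mulVecLin ⊔ Submodule.span ℂ {r₀} := by
    rw [Submodule.span_le]
    rintro v ⟨j, -, rfl⟩
    exact hmem j
  refine (Submodule.finrank_mono hle).trans ((Submodule.finrank_add_le_finrank_add_finrank _ _).trans ?_)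
  have h1 : Module.finrank ℂ (LinearMap.range K.mulVecLin) = p := hrank
  have h2 : Module.finrank ℂ (Submodule.span ℂ {r₀}) ≤ 1 := by
    simpa using finrank_span_le_card (R := ℂ) ({r₀} : Set (Fin n → ℂ))
  omega
end

section
/- Suppose ξ ∈ ℂᵖ is nonzero and Σ₁V₁*U₁ ξ = 0. Then V₁Σ₁⁻¹ξ is a generalized eigenvector of order two of A = I_n + U₁Σ₁V₁* for the (defective) eigenvalue λ = 1: namely (A − I_n)² (V₁Σ₁⁻¹ξ) = 0, while (A − I_n)(V₁Σ₁⁻¹ξ) = U₁ξ ≠ 0. -/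
open Matrix

/-- If `ξ ≠ 0` and `S₁ V₁ᴴ U₁ ξ = 0`, then `V₁ S₁⁻¹ ξ` is a generalized eigenvector of
order two of `A = I + U₁ S₁ V₁ᴴ` for the defective eigenvalue `1`:
`(A - I)² (V₁ S₁⁻¹ ξ) = 0` while `(A - I)(V₁ S₁⁻¹ ξ) = U₁ ξ ≠ 0`.
(Here `S₁` plays the role of `Σ₁`.) -/
theorem generalized_eigenvector_order_two (n p : ℕ) (hp : 0 < p) (hpn : p ≤ n)
    (U₁ V₁ : Matrix (Fin n) (Fin p) ℂ) (S₁ : Matrix (Fin p) (Fin p) ℂ)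
    (hU : U₁ᴴ * U₁ = 1) (hV : V₁ᴴ * V₁ = 1) (hS : IsUnit S₁)
    (A : Matrix (Fin n) (Fin n) ℂ) (hA : A = 1 + U₁ * S₁ * V₁ᴴ)
    (ξ : Fin p → ℂ) (hξ : ξ ≠ 0) (hker : (S₁ * V₁ᴴ * U₁) *ᵥ ξ = 0) :
    ((A - 1) ^ 2) *ᵥ ((V₁ * S₁⁻¹) *ᵥ ξ) = 0 ∧
    (A - 1) *ᵥ ((V₁ * S₁⁻¹) *ᵥ ξ) = U₁ *ᵥ ξ ∧ U₁ *ᵥ ξ ≠ 0 := by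
  have hA1 : A - 1 = U₁ * S₁ * V₁ᴴ := by rw [hA]; exact add_sub_cancel_left _ _
  have hdet : IsUnit S₁.det := (Matrix.isUnit_iff_isUnit_det S₁).mp hS
  have hmul : U₁ * S₁ * V₁ᴴ * (V₁ * S₁⁻¹) = U₁ := by
    calc U₁ * S₁ * V₁ᴴ * (V₁ * S₁⁻¹) = U₁ * (S₁ * ((V₁ᴴ * V₁) * S₁⁻¹)) := by
          simp only [Matrix.mul_assoc]
      _ = U₁ := by rw [hV, Matrix.one_mul, Matrix.mul_nonsing_inv _ hdet, Matrix.mul_one]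
  have h1 : (A - 1) *ᵥ ((V₁ * S₁⁻¹) *ᵥ ξ) = U₁ *ᵥ ξ := by
    rw [hA1, Matrix.mulVec_mulVec, hmul]
  refine ⟨?_, h1, ?_⟩
  · rw [pow_two, ← Matrix.mulVec_mulVec, h1, hA1, Matrix.mulVec_mulVec]
    have h2 : U₁ * S₁ * V₁ᴴ * U₁ = U₁ * (S₁ * V₁ᴴ * U₁) := by
      simp only [Matrix.mul_assoc]
    rw [h2, ← Matrix.mulVec_mulVec, hker, Matrix.mulVec_zero]
  · intro h0
    apply hξ
    have h3 : U₁ᴴ *ᵥ (U₁ *ᵥ ξ) = ξ := by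
      rw [Matrix.mulVec_mulVec, hU, Matrix.one_mulVec]
    rw [← h3, h0, Matrix.mulVec_zero]
end

section
/- For every γ ∈ ℂ, every natural number k, and every ξ ∈ ℂᵖ: (Σ₁V₁*U₁ − γ I_p)^k ξ = 0 if and only if (A − (γ + 1) I_n)^k (U₁ξ) = 0. In particular, a generalized eigenvector ξ of order k of Σ₁V₁*U₁ corresponding to eigenvalue γ yields a generalized eigenvector U₁ξ of the same order k of A = I_n + U₁Σ₁V₁* corresponding to eigenvalue λ = γ + 1. -/
open Matrix

/-- For every `γ`, `k`, `ξ`: `(S₁ V₁ᴴ U₁ - γ Iₚ)^k ξ = 0` iff `(A - (γ+1) Iₙ)^k (U₁ ξ) = 0`.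
In particular a generalized eigenvector `ξ` of order `k` of `S₁ V₁ᴴ U₁` for eigenvalue `γ`
yields a generalized eigenvector `U₁ ξ` of the same order `k` of `A = I + U₁ S₁ V₁ᴴ` for
eigenvalue `λ = γ + 1`. (Here `S₁` plays the role of `Σ₁`.) -/
theorem generalized_eigenvector_correspondence (n p : ℕ) (hp : 0 < p) (hpn : p ≤ n)
    (U₁ V₁ : Matrix (Fin n) (Fin p) ℂ) (S₁ : Matrix (Fin p) (Fin p) ℂ)
    (hU : U₁ᴴ * U₁ = 1) (hV : V₁ᴴ * V₁ = 1) (hS : IsUnit S₁)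
    (A : Matrix (Fin n) (Fin n) ℂ) (hA : A = 1 + U₁ * S₁ * V₁ᴴ) :
    (∀ (γ : ℂ) (k : ℕ) (ξ : Fin p → ℂ),
      ((S₁ * V₁ᴴ * U₁ - γ • (1 : Matrix (Fin p) (Fin p) ℂ)) ^ k) *ᵥ ξ = 0 ↔
        ((A - (γ + 1) • (1 : Matrix (Fin n) (Fin n) ℂ)) ^ k) *ᵥ (U₁ *ᵥ ξ) = 0) ∧
    ∀ (γ : ℂ) (k : ℕ), 1 ≤ k → ∀ ξ : Fin p → ℂ,
      ((S₁ * V₁ᴴ * U₁ - γ • (1 : Matrix (Fin p) (Fin p) ℂ)) ^ k) *ᵥ ξ = 0 →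
      ((S₁ * V₁ᴴ * U₁ - γ • (1 : Matrix (Fin p) (Fin p) ℂ)) ^ (k - 1)) *ᵥ ξ ≠ 0 →
      ((A - (γ + 1) • (1 : Matrix (Fin n) (Fin n) ℂ)) ^ k) *ᵥ (U₁ *ᵥ ξ) = 0 ∧
        ((A - (γ + 1) • (1 : Matrix (Fin n) (Fin n) ℂ)) ^ (k - 1)) *ᵥ (U₁ *ᵥ ξ) ≠ 0 := by
  have h1 : ∀ γ : ℂ, (A - (γ + 1) • (1 : Matrix (Fin n) (Fin n) ℂ)) * U₁ =
      U₁ * (S₁ * V₁ᴴ * U₁ - γ • (1 : Matrix (Fin p) (Fin p) ℂ)) := by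
    intro γ
    have h0 : A - (γ + 1) • (1 : Matrix (Fin n) (Fin n) ℂ) = U₁ * S₁ * V₁ᴴ - γ • 1 := by
      rw [hA, add_smul, one_smul]
      abel
    rw [h0, Matrix.sub_mul, Matrix.mul_sub, Matrix.smul_mul, Matrix.mul_smul, Matrix.one_mul,
      Matrix.mul_one]
    simp only [Matrix.mul_assoc]
  have h2 : ∀ (γ : ℂ) (k : ℕ), (A - (γ + 1) • (1 : Matrix (Fin n) (Fin n) ℂ)) ^ k * U₁ =
      U₁ * (S₁ * V₁ᴴ * U₁ - γ • (1 : Matrix (Fin p) (Fin p) ℂ)) ^ k := by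
    intro γ k
    induction k with
    | zero => simp
    | succ k ih => rw [pow_succ, Matrix.mul_assoc, h1, ← Matrix.mul_assoc, ih, Matrix.mul_assoc,
        ← pow_succ]
  have key : ∀ (γ : ℂ) (k : ℕ) (ξ : Fin p → ℂ),
      ((S₁ * V₁ᴴ * U₁ - γ • (1 : Matrix (Fin p) (Fin p) ℂ)) ^ k) *ᵥ ξ = 0 ↔
        ((A - (γ + 1) • (1 : Matrix (Fin n) (Fin n) ℂ)) ^ k) *ᵥ (U₁ *ᵥ ξ) = 0 := by
    intro γ k ξ
    rw [Matrix.mulVec_mulVec, h2, ← Matrix.mulVec_mulVec]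
    constructor
    · intro h
      rw [h, Matrix.mulVec_zero]
    · intro h
      have h3 := congrArg (fun v => U₁ᴴ *ᵥ v) h
      simpa only [Matrix.mulVec_mulVec, ← Matrix.mul_assoc, hU, Matrix.one_mul,
        Matrix.mulVec_zero] using h3
  exact ⟨key, fun γ k _ ξ ha hb => ⟨(key γ k ξ).1 ha, fun h => hb ((key γ (k - 1) ξ).2 h)⟩⟩
end

section
/- Let M = Σ₁V₁*U₁ and suppose ξ ∈ ℂᵖ is a generalized eigenvector of order s ≥ 1 of M for eigenvalue 0, i.e., M^s ξ = 0 and M^{s−1} ξ ≠ 0. Then V₁Σ₁⁻¹ξ is a generalized eigenvector of order s + 1 of A = I_n + U₁Σ₁V₁* for eigenvalue 1: (A − I_n)^{s+1} (V₁Σ₁⁻¹ξ) = 0 while (A − I_n)^{s} (V₁Σ₁⁻¹ξ) = U₁ M^{s−1} ξ ≠ 0. Thus a Jordan chain of length s of Σ₁V₁*U₁ at eigenvalue 0 gives a Jordan chain of A at eigenvalue 1 of length s + 1. -/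
open Matrix

/-- If `ξ` is a generalized eigenvector of order `s ≥ 1` of `M = S₁ V₁ᴴ U₁` for eigenvalue `0`
(`M^s ξ = 0`, `M^{s-1} ξ ≠ 0`), then `V₁ S₁⁻¹ ξ` is a generalized eigenvector of order `s + 1`
of `A = I + U₁ S₁ V₁ᴴ` for eigenvalue `1`: `(A - I)^{s+1} (V₁ S₁⁻¹ ξ) = 0` while
`(A - I)^s (V₁ S₁⁻¹ ξ) = U₁ M^{s-1} ξ ≠ 0`. (Here `S₁` plays the role of `Σ₁`.) -/
theorem jordan_chain_extension (n p : ℕ) (hp : 0 < p) (hpn : p ≤ n)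
    (U₁ V₁ : Matrix (Fin n) (Fin p) ℂ) (S₁ : Matrix (Fin p) (Fin p) ℂ)
    (hU : U₁ᴴ * U₁ = 1) (hV : V₁ᴴ * V₁ = 1) (hS : IsUnit S₁)
    (A : Matrix (Fin n) (Fin n) ℂ) (hA : A = 1 + U₁ * S₁ * V₁ᴴ)
    (M : Matrix (Fin p) (Fin p) ℂ) (hM : M = S₁ * V₁ᴴ * U₁)
    (ξ : Fin p → ℂ) (s : ℕ) (hs : 1 ≤ s)
    (h₁ : (M ^ s) *ᵥ ξ = 0) (h₂ : (M ^ (s - 1)) *ᵥ ξ ≠ 0) :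
    ((A - 1) ^ (s + 1)) *ᵥ ((V₁ * S₁⁻¹) *ᵥ ξ) = 0 ∧
    ((A - 1) ^ s) *ᵥ ((V₁ * S₁⁻¹) *ᵥ ξ) = U₁ *ᵥ ((M ^ (s - 1)) *ᵥ ξ) ∧
    U₁ *ᵥ ((M ^ (s - 1)) *ᵥ ξ) ≠ 0 := by
  have hK : A - 1 = U₁ * S₁ * V₁ᴴ := by rw [hA]; simp
  have hdet : IsUnit S₁.det := (Matrix.isUnit_iff_isUnit_det S₁).mp hS
  have base : (A - 1) * (V₁ * S₁⁻¹) = U₁ := by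
    rw [hK]
    calc U₁ * S₁ * V₁ᴴ * (V₁ * S₁⁻¹) = U₁ * (S₁ * (V₁ᴴ * V₁) * S₁⁻¹) := by
          simp only [Matrix.mul_assoc]
      _ = U₁ := by rw [hV, Matrix.mul_one, Matrix.mul_nonsing_inv _ hdet, Matrix.mul_one]
  have step : (A - 1) * U₁ = U₁ * M := by
    rw [hK, hM]; simp only [Matrix.mul_assoc]
  have key : ∀ k : ℕ, (A - 1) ^ (k + 1) * (V₁ * S₁⁻¹) = U₁ * M ^ k := by
    intro k
    induction k with
    | zero => simpa using base
    | succ k ih =>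
      rw [pow_succ' (A - 1) (k + 1), Matrix.mul_assoc, ih, ← Matrix.mul_assoc, step,
        Matrix.mul_assoc, ← pow_succ']
  obtain ⟨k, rfl⟩ : ∃ k, s = k + 1 := ⟨s - 1, by omega⟩
  simp only [Nat.add_sub_cancel] at h₂ ⊢
  refine ⟨?_, ?_, ?_⟩
  · rw [Matrix.mulVec_mulVec, key, ← Matrix.mulVec_mulVec, h₁, Matrix.mulVec_zero]
  · rw [Matrix.mulVec_mulVec, key, ← Matrix.mulVec_mulVec]
  · intro h
    apply h₂
    have h' := congrArg (fun v => U₁ᴴ *ᵥ v) h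
    simp only [Matrix.mulVec_zero] at h'
    rwa [Matrix.mulVec_mulVec, hU, Matrix.one_mulVec] at h'
end
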